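/- arXiv:1603.00316 — 3 statements merged into one kernel-verified Lean document; each statement's English description precedes it below -/
import Mathlib

section
/- Let D be a finite subset of the unit sphere S^{N-1} in ℝ^N with |D| ≤ N. Then D is not a proper quantization. -/
open Real Filter RealInnerProductSpace

noncomputable section

/-- The set of minimizers of `f` over all of `ℝ^N`. -/
def minimizers {N : ℕ} (f : EuclideanSpace ℝ (Fin N) → ℝ) : Set (EuclideanSpace ℝ (Fin N)) :=
  {x | ∀ y, f x ≤ f y}

/-- `D` is a proper quantization: for every convex differentiable objective with
`L`-Lipschitz gradient and nonempty bounded set of minimizers, and every starting point,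
one can choose directions in `D` and nonnegative step-sizes so that the iterates
`x(t+1) = x(t) - γ(t) • d(t)` converge to the set of minimizers. -/
def ProperQuantization {N : ℕ} (D : Finset (EuclideanSpace ℝ (Fin N))) : Prop :=
  ∀ f : EuclideanSpace ℝ (Fin N) → ℝ,
    ConvexOn ℝ Set.univ f → Differentiable ℝ f →
    (∃ L : ℝ, 0 < L ∧ ∀ x y, ‖gradient f x - gradient f y‖ ≤ L * ‖x - y‖) →
    (minimizers f).Nonempty → Bornology.IsBounded (minimizers f) →
    ∀ x₀ : EuclideanSpace ℝ (Fin N),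
      ∃ (γ : ℕ → ℝ) (d : ℕ → EuclideanSpace ℝ (Fin N)) (x : ℕ → EuclideanSpace ℝ (Fin N)),
        (∀ t, 0 ≤ γ t) ∧ (∀ t, d t ∈ D) ∧ x 0 = x₀ ∧
        (∀ t, x (t + 1) = x t - γ t • d t) ∧
        Tendsto (fun t => Metric.infDist (x t) (minimizers f)) atTop (nhds 0)

theorem exists_ne_zero_inner_nonneg {N : ℕ} (hN : 1 ≤ N)
    (D : Finset (EuclideanSpace ℝ (Fin N))) (hcard : D.card ≤ N) :
    ∃ v : EuclideanSpace ℝ (Fin N), v ≠ 0 ∧ ∀ d ∈ D, 0 ≤ inner ℝ d v := by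
  let T : EuclideanSpace ℝ (Fin N) →ₗ[ℝ] (D → ℝ) :=
    LinearMap.pi fun d => (innerSL ℝ (d : EuclideanSpace ℝ (Fin N))).toLinearMap
  have hT : ∀ v (d : D), T v d = inner ℝ (d : EuclideanSpace ℝ (Fin N)) v := fun _ _ => rfl
  by_cases hinj : Function.Injective T
  · have hle := LinearMap.finrank_le_finrank_of_injective hinj
    have hDN : D.card = N := by
      simp only [finrank_euclideanSpace, Fintype.card_fin, Module.finrank_fintype_fun_eq_card,
        Fintype.card_coe] at hle
      omega
    have hfin : Module.finrank ℝ (EuclideanSpace ℝ (Fin N)) = Module.finrank ℝ (D → ℝ) := by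
      simp [hDN]
    obtain ⟨v, hv⟩ :=
      (LinearMap.injective_iff_surjective_of_finrank_eq_finrank hfin).1 hinj (fun _ => 1)
    have hone : ∀ d ∈ D, inner ℝ d v = (1 : ℝ) := fun d hd => by
      rw [← hT v ⟨d, hd⟩, hv]
    refine ⟨v, ?_, fun d hd => by simp [hone d hd]⟩
    rintro rfl
    obtain ⟨d, hd⟩ := Finset.card_pos.1 (by omega : 0 < D.card)
    simpa using hone d hd
  · rw [injective_iff_map_eq_zero] at hinj
    push Not at hinj
    obtain ⟨v, hv, hne⟩ := hinj
    exact ⟨v, hne, fun d hd => by rw [← hT v ⟨d, hd⟩, hv]; simp⟩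

theorem gradient_norm_sq {E : Type*} [NormedAddCommGroup E] [InnerProductSpace ℝ E]
    [CompleteSpace E] (x : E) : gradient (fun y : E => ‖y‖ ^ 2) x = (2 : ℝ) • x := by
  refine HasGradientAt.gradient ?_
  rw [hasGradientAt_iff_hasFDerivAt]
  have h : InnerProductSpace.toDual ℝ E ((2 : ℝ) • x) = 2 • innerSL ℝ x := by
    ext y
    simp [two_smul]
  rw [h]
  exact (hasStrictFDerivAt_norm_sq x).hasFDerivAt

theorem minimizers_norm_sq {N : ℕ} :
    minimizers (fun x : EuclideanSpace ℝ (Fin N) => ‖x‖ ^ 2) = {0} := by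
  ext x
  simp only [minimizers, Set.mem_ofPred_eq, Set.mem_singleton_iff]
  refine ⟨fun h => ?_, ?_⟩
  · have h0 := h 0
    rw [norm_zero] at h0
    have : ‖x‖ = 0 := by nlinarith [norm_nonneg x]
    exact norm_eq_zero.1 this
  · rintro rfl y
    simp

/-- Theorem 2: a finite subset of the unit sphere with at most `N` elements
is not a proper quantization. -/
theorem not_properQuantization_of_card_le {N : ℕ} (hN : 1 ≤ N)
    (D : Finset (EuclideanSpace ℝ (Fin N))) (hD : ∀ d ∈ D, ‖d‖ = 1)
    (hcard : D.card ≤ N) :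
    ¬ ProperQuantization D := by
  intro hPQ
  obtain ⟨v, hv, hvD⟩ := exists_ne_zero_inner_nonneg hN D hcard
  obtain ⟨γ, d, x, hγ, hd, hx0, hx, hlim⟩ := hPQ (fun x => ‖x‖ ^ 2)
    ((convexOn_norm convex_univ).pow (fun _ _ => norm_nonneg _) 2)
    (differentiable_id.norm_sq ℝ)
    ⟨2, two_pos, fun x y => by
      rw [gradient_norm_sq, gradient_norm_sq, ← smul_sub, norm_smul]; simp⟩
    (by rw [minimizers_norm_sq]; exact Set.singleton_nonempty 0)
    (by rw [minimizers_norm_sq]; exact Bornology.isBounded_singleton) (-v)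
  simp only [minimizers_norm_sq, Metric.infDist_singleton, dist_zero_right] at hlim
  have hvpos : 0 < ‖v‖ := norm_pos_iff.2 hv
  have hinner : ∀ t, inner ℝ (x t) v ≤ -‖v‖ ^ 2 := by
    intro t
    induction t with
    | zero => simp [hx0]
    | succ t ih =>
      rw [hx t, inner_sub_left, real_inner_smul_left]
      linarith [mul_nonneg (hγ t) (hvD _ (hd t))]
  have hnorm : ∀ t, ‖v‖ ≤ ‖x t‖ := by
    intro t
    have hcs := abs_le.1 (abs_real_inner_le_norm (x t) v)
    nlinarith [hinner t, hcs.1]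
  exact hvpos.not_ge (ge_of_tendsto' hlim hnorm)
end
end

section
/- Fix T ∈ ℕ with T ≥ 1 and a constant K > 0 with K ≥ f(x(0)) − f*. If the quantized gradient iterates are run with the constant step-size γ = √( 2K / (L T) ), then min_{0 ≤ t ≤ T} ‖∇f(x(t))‖ ≤ √(2 L K) / ( cos θ · √T ). -/
open Real Filter RealInnerProductSpace

noncomputable section

/-- Descent lemma: the quadratic upper bound for a function with `L`-Lipschitz gradient. -/
theorem le_add_inner_gradient_add_of_lipschitz {E : Type*} [NormedAddCommGroup E]
    [InnerProductSpace ℝ E] [CompleteSpace E] {f : E → ℝ} (hf : Differentiable ℝ f) {L : ℝ}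
    (hL : ∀ x y, ‖gradient f x - gradient f y‖ ≤ L * ‖x - y‖) (x v : E) :
    f (x + v) ≤ f x + ⟪gradient f x, v⟫ + L / 2 * ‖v‖ ^ 2 := by
  let φ : ℝ → ℝ := fun s ↦ f (x + s • v) - s * ⟪gradient f x, v⟫ - L / 2 * ‖v‖ ^ 2 * s ^ 2
  have hφ (s : ℝ) : HasDerivAt φ
      (⟪gradient f (x + s • v), v⟫ - ⟪gradient f x, v⟫ - L / 2 * ‖v‖ ^ 2 * (2 * s)) s := by
    have hline : HasDerivAt (fun s : ℝ ↦ x + s • v) v s := by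
      simpa using ((hasDerivAt_id s).smul_const v).const_add x
    have hcomp := (hf (x + s • v)).hasGradientAt.hasFDerivAt.comp_hasDerivAt s hline
    rw [InnerProductSpace.toDual_apply_apply] at hcomp
    have hlin := (hasDerivAt_id s).mul_const ⟪gradient f x, v⟫
    have hsq := ((hasDerivAt_id s).pow 2).const_mul (L / 2 * ‖v‖ ^ 2)
    exact ((hcomp.sub hlin).sub hsq).congr_deriv (by simp)
  have hanti : AntitoneOn φ (Set.Icc 0 1) := by
    refine antitoneOn_of_deriv_nonpos (convex_Icc 0 1)
      (fun s _ ↦ (hφ s).continuousAt.continuousWithinAt)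
      (fun s _ ↦ (hφ s).differentiableAt.differentiableWithinAt) fun s hs ↦ ?_
    rw [interior_Icc] at hs
    rw [(hφ s).deriv, ← inner_sub_left]
    have hlip := hL (x + s • v) x
    rw [add_sub_cancel_left, norm_smul, Real.norm_of_nonneg hs.1.le] at hlip
    nlinarith [real_inner_le_norm (gradient f (x + s • v) - gradient f x) v,
      mul_le_mul_of_nonneg_right hlip (norm_nonneg v)]
  have h01 := hanti (by simp) (by simp) zero_le_one
  simp only [φ, one_smul, zero_smul, add_zero] at h01
  linarith

/-- Corollary 2: for any upper bound `K ≥ f(x(0)) - f*`, running the quantized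
gradient iterates with the constant step-size `γ = √(2K/(LT))` guarantees
`min_{0 ≤ t ≤ T} ‖∇f(x(t))‖ ≤ √(2LK)/(cosθ·√T)`. -/
theorem accuracy_with_upper_bound_K {N : ℕ} (hN : 1 ≤ N)
    (f : EuclideanSpace ℝ (Fin N) → ℝ)
    (hconv : ConvexOn ℝ Set.univ f) (hdiff : Differentiable ℝ f)
    (L : ℝ) (hL : 0 < L)
    (hLip : ∀ x y, ‖gradient f x - gradient f y‖ ≤ L * ‖x - y‖)
    (hXne : {x : EuclideanSpace ℝ (Fin N) | ∀ y, f x ≤ f y}.Nonempty)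
    (hXbd : Bornology.IsBounded {x : EuclideanSpace ℝ (Fin N) | ∀ y, f x ≤ f y})
    (fstar : ℝ) (hfstar : IsLeast (Set.range f) fstar)
    (θ : ℝ) (hθ : θ ∈ Set.Ico 0 (π / 2))
    (D : Finset (EuclideanSpace ℝ (Fin N))) (hD : ∀ d ∈ D, ‖d‖ = 1)
    (hcover : ∀ g : EuclideanSpace ℝ (Fin N), ‖g‖ = 1 → ∃ d ∈ D, Real.cos θ ≤ ⟪g, d⟫)
    (T : ℕ) (hT : 1 ≤ T)
    (x₀ : EuclideanSpace ℝ (Fin N))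
    (K : ℝ) (hKpos : 0 < K) (hK : f x₀ - fstar ≤ K)
    (γ : ℝ) (hγ : γ = Real.sqrt (2 * K / (L * T)))
    -- the quantized gradient iterates started at `x₀`
    (x d : ℕ → EuclideanSpace ℝ (Fin N)) (hx0 : x 0 = x₀)
    (hdD : ∀ t, d t ∈ D)
    (hang : ∀ t, Real.cos θ * ‖gradient f (x t)‖ ≤ ⟪gradient f (x t), d t⟫)
    (hiter : ∀ t, x (t + 1) = x t - γ • d t) :
    ∃ t ≤ T, ‖gradient f (x t)‖ ≤
      Real.sqrt (2 * L * K) / (Real.cos θ * Real.sqrt T) := by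
  have hcos : 0 < Real.cos θ :=
    Real.cos_pos_of_mem_Ioo ⟨by linarith [hθ.1, Real.pi_pos], hθ.2⟩
  have hT0 : (0 : ℝ) < T := by exact_mod_cast hT
  have hγ0 : 0 ≤ γ := hγ ▸ Real.sqrt_nonneg _
  have hγsq : L * T * γ ^ 2 = 2 * K := by
    rw [hγ, Real.sq_sqrt (by positivity)]
    field_simp
  have hγpos : 0 < γ := hγ ▸ Real.sqrt_pos.2 (by positivity)
  have hbound : Real.sqrt (2 * L * K) / (Real.cos θ * Real.sqrt T) = L * γ / Real.cos θ := by
    have hsqrt : Real.sqrt (2 * L * K) = L * γ * Real.sqrt T := by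
      rw [Real.sqrt_eq_iff_mul_self_eq (by positivity) (by positivity)]
      linear_combination -L ^ 2 * γ ^ 2 * Real.mul_self_sqrt hT0.le - L * hγsq
    have := Real.sqrt_pos.2 hT0
    rw [hsqrt]
    field_simp
  rw [hbound]
  by_contra! hlarge
  have hstep (t : ℕ) (ht : t ≤ T) : f (x (t + 1)) < f (x t) - L / 2 * γ ^ 2 := by
    have hdesc := le_add_inner_gradient_add_of_lipschitz hdiff hLip (x t) (-(γ • d t))
    rw [← sub_eq_add_neg, ← hiter, inner_neg_right, real_inner_smul_right, norm_neg, norm_smul,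
      hD _ (hdD t), mul_one, Real.norm_of_nonneg hγ0] at hdesc
    have hgrad := (div_lt_iff₀' hcos).1 (hlarge t ht)
    nlinarith [mul_lt_mul_of_pos_left (hgrad.trans_le (hang t)) hγpos]
  have hsum (t : ℕ) (ht : t ≤ T) : f (x t) ≤ f x₀ - t * (L / 2 * γ ^ 2) := by
    induction t with
    | zero => simp [hx0]
    | succ t ih =>
      push_cast
      linarith [ih (by omega), hstep t (by omega)]
  linarith [hstep T le_rfl, hsum T le_rfl, hfstar.2 ⟨x (T + 1), rfl⟩,
    show 0 < L / 2 * γ ^ 2 by positivity]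
end
end

section
/- Suppose in addition that f is μ-strongly convex for some μ > 0. Fix ε > 0 and a constant step-size γ(t) = γ with γ ∈ (0, γ̄) where γ̄ = min{ 2 cos θ · √(μ ε) / L , √(ε/L) }. Then there exists T ∈ ℕ with T ≤ ⌈ 2(f(x(0)) − f*) / ( γ (2 cos θ · √(μ ε) − L γ) ) ⌉ such that the quantized gradient iterates satisfy f(x(t)) − f* ≤ ε for all t ≥ T. -/
open Real Filter RealInnerProductSpace

noncomputable section

section DescentLemmas

variable {E : Type*} [NormedAddCommGroup E] [InnerProductSpace ℝ E]

/-- Descent lemma: the quadratic upper bound for a function with `L`-Lipschitz gradient. -/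
theorem le_add_inner_gradient_add_sq [CompleteSpace E] {f : E → ℝ} (hdiff : Differentiable ℝ f)
    {L : ℝ} (hLip : ∀ x y, ‖gradient f x - gradient f y‖ ≤ L * ‖x - y‖) (x v : E) :
    f (x + v) ≤ f x + ⟪gradient f x, v⟫ + L / 2 * ‖v‖ ^ 2 := by
  let h : ℝ → ℝ := fun s => f (x + s • v) - s * ⟪gradient f x, v⟫ - L / 2 * ‖v‖ ^ 2 * s ^ 2
  have hline : ∀ s : ℝ, HasDerivAt (fun s : ℝ => x + s • v) v s := fun s => by
    simpa using ((hasDerivAt_id s).smul_const v).const_add x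
  have hf : ∀ s : ℝ, HasDerivAt (fun s : ℝ => f (x + s • v)) ⟪gradient f (x + s • v), v⟫ s := by
    intro s
    have hg := (hdiff (x + s • v)).hasGradientAt.hasFDerivAt
    simpa [Function.comp_def] using hg.comp_hasDerivAt s (hline s)
  have hh : ∀ s : ℝ, HasDerivAt h
      (⟪gradient f (x + s • v), v⟫ - ⟪gradient f x, v⟫ - L * s * ‖v‖ ^ 2) s := by
    intro s
    refine (((hf s).sub ((hasDerivAt_id s).mul_const ⟪gradient f x, v⟫)).sub
      ((hasDerivAt_pow 2 s).const_mul (L / 2 * ‖v‖ ^ 2))).congr_deriv ?_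
    norm_num
    ring
  have hanti : AntitoneOn h (Set.Icc 0 1) := by
    refine antitoneOn_of_deriv_nonpos (convex_Icc 0 1)
      (fun s _ => (hh s).continuousAt.continuousWithinAt)
      (fun s _ => (hh s).differentiableAt.differentiableWithinAt) fun s hs => ?_
    rw [interior_Icc] at hs
    rw [(hh s).deriv, ← inner_sub_left]
    have h₁ := real_inner_le_norm (gradient f (x + s • v) - gradient f x) v
    have h₂ := hLip (x + s • v) x
    rw [add_sub_cancel_left, norm_smul, Real.norm_of_nonneg hs.1.le] at h₂
    nlinarith [mul_le_mul_of_nonneg_right h₂ (norm_nonneg v)]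
  have h₀₁ := hanti (Set.left_mem_Icc.2 zero_le_one) (Set.right_mem_Icc.2 zero_le_one) zero_le_one
  simp only [h, one_smul, zero_smul, add_zero] at h₀₁
  linarith

/-- The gradient-domination inequality extracted from a strongly convex lower bound. -/
theorem two_mul_sub_le_norm_sq_of_quadratic_lower_bound {a b μ : ℝ} (hμ : 0 < μ) {g v : E}
    (h : a + ⟪g, v⟫ + μ / 2 * ‖v‖ ^ 2 ≤ b) : 2 * μ * (a - b) ≤ ‖g‖ ^ 2 := by
  have h₁ := neg_le_of_abs_le (abs_real_inner_le_norm g v)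
  nlinarith [sq_nonneg (‖g‖ - μ * ‖v‖)]

end DescentLemmas

/-- A sequence which at each step drops by `c` or falls below `ε` stays below
`max ε (u 0 - t * c)`. -/
theorem le_max_sub_mul_of_le_max_sub {u : ℕ → ℝ} {ε c : ℝ} (hc : 0 ≤ c)
    (h : ∀ t, u (t + 1) ≤ max ε (u t - c)) (t : ℕ) : u t ≤ max ε (u 0 - t * c) := by
  induction t with
  | zero => simp
  | succ t ih =>
    refine (h t).trans (max_le (le_max_left _ _) ?_)
    push_cast
    rcases le_max_iff.1 ih with ih | ih
    · exact le_max_of_le_left (by linarith)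
    · exact le_max_of_le_right (by linarith)

/-- Theorem 7-b (Type-2 stopping under strong convexity): if moreover `f` is
`μ`-strongly convex and the constant step-size satisfies
`γ ∈ (0, min{2cosθ√(με)/L, √(ε/L)})`, then there exists
`T ≤ ⌈2(f(x(0)) - f*)/(γ(2cosθ√(με) - Lγ))⌉` such that
`f(x(t)) - f* ≤ ε` for all `t ≥ T`. -/
theorem type2_stopping_quantized_strongly_convex {N : ℕ} (hN : 1 ≤ N)
    (f : EuclideanSpace ℝ (Fin N) → ℝ)
    (hconv : ConvexOn ℝ Set.univ f) (hdiff : Differentiable ℝ f)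
    (L : ℝ) (hL : 0 < L)
    (hLip : ∀ x y, ‖gradient f x - gradient f y‖ ≤ L * ‖x - y‖)
    (hXne : {x : EuclideanSpace ℝ (Fin N) | ∀ y, f x ≤ f y}.Nonempty)
    (hXbd : Bornology.IsBounded {x : EuclideanSpace ℝ (Fin N) | ∀ y, f x ≤ f y})
    (fstar : ℝ) (hfstar : IsLeast (Set.range f) fstar)
    (μ : ℝ) (hμ : 0 < μ)
    (hsconv : ∀ x y : EuclideanSpace ℝ (Fin N),
      f x + ⟪gradient f x, y - x⟫ + μ / 2 * ‖y - x‖ ^ 2 ≤ f y)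
    (θ : ℝ) (hθ : θ ∈ Set.Ico 0 (π / 2))
    (D : Finset (EuclideanSpace ℝ (Fin N))) (hD : ∀ d ∈ D, ‖d‖ = 1)
    (hcover : ∀ g : EuclideanSpace ℝ (Fin N), ‖g‖ = 1 → ∃ d ∈ D, Real.cos θ ≤ ⟪g, d⟫)
    (ε γ : ℝ) (hε : 0 < ε)
    (hγ : γ ∈ Set.Ioo 0
      (min (2 * Real.cos θ * Real.sqrt (μ * ε) / L) (Real.sqrt (ε / L))))
    -- the quantized gradient iterates
    (x d : ℕ → EuclideanSpace ℝ (Fin N))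
    (hdD : ∀ t, d t ∈ D)
    (hang : ∀ t, Real.cos θ * ‖gradient f (x t)‖ ≤ ⟪gradient f (x t), d t⟫)
    (hiter : ∀ t, x (t + 1) = x t - γ • d t) :
    ∃ T : ℕ,
      T ≤ ⌈2 * (f (x 0) - fstar) / (γ * (2 * Real.cos θ * Real.sqrt (μ * ε) - L * γ))⌉₊ ∧
      ∀ t, T ≤ t → f (x t) - fstar ≤ ε := by
  obtain ⟨⟨z, rfl⟩, -⟩ := hfstar
  obtain ⟨hγ0, hγ⟩ := hγ
  obtain ⟨hγ₁, hγ₂⟩ := lt_min_iff.1 hγ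
  have hcos : 0 < Real.cos θ :=
    Real.cos_pos_of_mem_Ioo ⟨by linarith [hθ.1, Real.pi_pos], hθ.2⟩
  rw [lt_div_iff₀ hL] at hγ₁
  rw [Real.lt_sqrt hγ0.le, lt_div_iff₀ hL] at hγ₂
  set s := Real.sqrt (μ * ε)
  set c := γ * (2 * Real.cos θ * s - L * γ) with hc
  have hcpos : 0 < c := mul_pos hγ0 (by linarith)
  have hdescent : ∀ t,
      f (x (t + 1)) ≤ f (x t) - γ * (Real.cos θ * ‖gradient f (x t)‖) + L / 2 * γ ^ 2 := by
    intro t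
    have h := le_add_inner_gradient_add_sq hdiff hLip (x t) (-(γ • d t))
    rw [← sub_eq_add_neg, ← hiter, inner_neg_right, real_inner_smul_right, norm_neg, norm_smul,
      hD _ (hdD t), Real.norm_of_nonneg hγ0.le, mul_one] at h
    linarith [mul_le_mul_of_nonneg_left (hang t) hγ0.le]
  have hstep : ∀ t, f (x (t + 1)) - f z ≤ max ε (f (x t) - f z - c / 2) := by
    intro t
    have hgrad := two_mul_sub_le_norm_sq_of_quadratic_lower_bound hμ (hsconv (x t) z)
    rcases le_total (ε / 2) (f (x t) - f z) with hlarge | hsmall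
    · have hs : s ≤ ‖gradient f (x t)‖ :=
        Real.sqrt_le_iff.2 ⟨norm_nonneg _, by nlinarith⟩
      have h := mul_le_mul_of_nonneg_left hs (mul_pos hγ0 hcos).le
      exact le_max_of_le_right (by linarith [hdescent t])
    · have h : 0 ≤ γ * (Real.cos θ * ‖gradient f (x t)‖) := by positivity
      exact le_max_of_le_left (by linarith [hdescent t])
  refine ⟨_, le_rfl, fun t ht => ?_⟩
  have hmax := le_max_sub_mul_of_le_max_sub (u := fun t => f (x t) - f z) (half_pos hcpos).le
    hstep t
  have ht' := Nat.ceil_le.1 ht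
  rw [div_le_iff₀ hcpos] at ht'
  exact hmax.trans (max_le le_rfl (by linarith))
end
end
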